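/- (Infeasible points are not Clarke stationary for the exact penalty.) Let T : ℝᵈ → ℝ be globally Lipschitz continuous with Lipschitz constant L_T, let R : ℝᵈ → ℝ be locally Lipschitz, let c > 0, and let ρ > L_T / c. If at a point θ ∈ ℝᵈ there exists a nonzero vector ϑ ∈ ℝᵈ with R°(θ; ϑ) ≤ −c‖ϑ‖, then (T + ρR)°(θ; ϑ) < 0; consequently it is not the case that (T + ρR)°(θ; u) ≥ 0 for all u ∈ ℝᵈ, i.e., θ is not a Clarke stationary point of T + ρR. -/

import Mathlib

open Filter

/-- The Clarke directional derivative
`κ°(θ; ϑ) = limsup_{θ' → θ, τ ↓ 0} (κ(θ' + τ ϑ) − κ(θ'))/τ`. -/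
noncomputable def clarkeDirDeriv {d : ℕ} (κ : EuclideanSpace ℝ (Fin d) → ℝ)
    (θ ϑ : EuclideanSpace ℝ (Fin d)) : ℝ :=
  Filter.limsup
    (fun p : EuclideanSpace ℝ (Fin d) × ℝ => (κ (p.1 + p.2 • ϑ) - κ p.1) / p.2)
    ((nhds θ) ×ˢ (nhdsWithin 0 (Set.Ioi 0)))

/-- Local bound on the difference quotients. -/
lemma quot_bound {d : ℕ} (R : EuclideanSpace ℝ (Fin d) → ℝ) (hR : LocallyLipschitz R)
    (θ ϑ : EuclideanSpace ℝ (Fin d)) : ∃ K : ℝ,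
    ∀ᶠ p : EuclideanSpace ℝ (Fin d) × ℝ in (nhds θ) ×ˢ (nhdsWithin 0 (Set.Ioi 0)),
      0 < p.2 ∧ |(R (p.1 + p.2 • ϑ) - R p.1) / p.2| ≤ K := by
  obtain ⟨K, t, ht, hK⟩ := hR θ
  refine ⟨K * ‖ϑ‖, ?_⟩
  have h1 : Tendsto (fun p : EuclideanSpace ℝ (Fin d) × ℝ => p.1)
      ((nhds θ) ×ˢ (nhdsWithin 0 (Set.Ioi 0))) (nhds θ) := tendsto_fst
  have h2' : Tendsto (fun p : EuclideanSpace ℝ (Fin d) × ℝ => p.2)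
      ((nhds θ) ×ˢ (nhdsWithin 0 (Set.Ioi 0))) (nhdsWithin 0 (Set.Ioi 0)) := tendsto_snd
  have h2 : Tendsto (fun p : EuclideanSpace ℝ (Fin d) × ℝ => p.2)
      ((nhds θ) ×ˢ (nhdsWithin 0 (Set.Ioi 0))) (nhds 0) := h2'.mono_right nhdsWithin_le_nhds
  have h3 := h1.add (h2.smul_const ϑ)
  rw [zero_smul, add_zero] at h3
  filter_upwards [h1 ht, h3 ht, h2' self_mem_nhdsWithin] with p hp1 hp3 hp2
  have hp2 : 0 < p.2 := hp2
  refine ⟨hp2, ?_⟩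
  have h := hK.dist_le_mul _ hp3 _ hp1
  rw [Real.dist_eq, dist_eq_norm, add_sub_cancel_left, norm_smul, Real.norm_eq_abs,
    abs_of_pos hp2] at h
  rw [abs_div, abs_of_pos hp2, div_le_iff₀ hp2]
  linarith

/-- infeasible points are not Clarke stationary for the exact penalty
function `T + ρ R` once the penalty parameter exceeds `L_T / c`. -/
theorem stmt_11 {d : ℕ} (T R : EuclideanSpace ℝ (Fin d) → ℝ)
    (L_T : NNReal) (hT : LipschitzWith L_T T)
    (hR : LocallyLipschitz R)
    (c ρ : ℝ) (hc : 0 < c) (hρ : (L_T : ℝ) / c < ρ)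
    (θ ϑ : EuclideanSpace ℝ (Fin d)) (hϑ : ϑ ≠ 0)
    (hdesc : clarkeDirDeriv R θ ϑ ≤ -c * ‖ϑ‖) :
    clarkeDirDeriv (fun y => T y + ρ * R y) θ ϑ < 0
    ∧ ¬ (∀ u : EuclideanSpace ℝ (Fin d),
          0 ≤ clarkeDirDeriv (fun y => T y + ρ * R y) θ u) := by
  have key : clarkeDirDeriv (fun y => T y + ρ * R y) θ ϑ < 0 := by
    have hn : 0 < ‖ϑ‖ := norm_pos_iff.mpr hϑ
    have hρ0 : 0 < ρ := lt_of_le_of_lt (by positivity) hρ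
    have hLc : (L_T : ℝ) < ρ * c := (div_lt_iff₀ hc).mp hρ
    obtain ⟨b, hb1, hb2⟩ : ∃ b, -c * ‖ϑ‖ < b ∧ b < -(L_T * ‖ϑ‖) / ρ := by
      apply exists_between
      rw [lt_div_iff₀ hρ0]
      nlinarith
    rw [lt_div_iff₀ hρ0] at hb2
    obtain ⟨K, hK⟩ := quot_bound R hR θ ϑ
    have hlt := eventually_lt_of_limsup_lt (lt_of_le_of_lt hdesc hb1)
      (isBoundedUnder_of_eventually_le (a := K) (hK.mono fun p hp => (abs_le.mp hp.2).2))
    have hTq : ∀ p : EuclideanSpace ℝ (Fin d) × ℝ, 0 < p.2 →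
        (T (p.1 + p.2 • ϑ) - T p.1) / p.2 ≤ L_T * ‖ϑ‖ := by
      intro p hp
      have h := hT.dist_le_mul (p.1 + p.2 • ϑ) p.1
      rw [Real.dist_eq, dist_eq_norm, add_sub_cancel_left, norm_smul, Real.norm_eq_abs,
        abs_of_pos hp] at h
      rw [div_le_iff₀ hp]
      linarith [le_abs_self (T (p.1 + p.2 • ϑ) - T p.1)]
    obtain ⟨M, hM⟩ := quot_bound (fun y => T y + ρ * R y)
      (hT.locallyLipschitz.add ((LipschitzWith.locallyLipschitz
        (lipschitzWith_smul ρ)).comp hR)) θ ϑ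
    refine lt_of_le_of_lt (b := L_T * ‖ϑ‖ + ρ * b) ?_ (by linarith)
    refine limsup_le_of_le ?_ ?_
    · exact (isBoundedUnder_of_eventually_ge (a := -M)
        (hM.mono fun p hp => (abs_le.mp hp.2).1)).isCoboundedUnder_le
    · filter_upwards [hlt, hM] with p hp hp'
      have e : (T (p.1 + p.2 • ϑ) + ρ * R (p.1 + p.2 • ϑ) - (T p.1 + ρ * R p.1)) / p.2
          = (T (p.1 + p.2 • ϑ) - T p.1) / p.2
            + ρ * ((R (p.1 + p.2 • ϑ) - R p.1) / p.2) := by ring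
      rw [e]
      have := mul_le_mul_of_nonneg_left hp.le hρ0.le
      linarith [hTq p hp'.1]
  exact ⟨key, fun h => absurd (h ϑ) (not_le.mpr key)⟩
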